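/- Suppose ↪_{β𝓡} is confluent and 𝓡 is arity-preserving. Then the type erasure ⌈·⌉ is invariant under substitution, reduction and conversion: (1) if ⌈A⌉ is defined then for every term N, ⌈A{N/x}⌉ is defined and equals ⌈A⌉; (2) if A ↪_{β𝓡} A' and ⌈A⌉ is defined, then ⌈A'⌉ is defined and ⌈A⌉ = ⌈A'⌉; (3) if A ≡_{β𝓡} A' and both ⌈A⌉ and ⌈A'⌉ are defined, then ⌈A⌉ = ⌈A'⌉. -/

import Mathlib

namespace DKPaper

inductive Tm (C : Type) : Type
  | var : Nat → Tm C
  | const : C → List (Tm C) → Tm C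
  | type : Tm C
  | kind : Tm C
  | app : Tm C → Tm C → Tm C
  | lam : Tm C → Tm C → Tm C
  | pi : Tm C → Tm C → Tm C

namespace Tm
variable {C : Type}

def liftRen (ρ : Nat → Nat) : Nat → Nat
  | 0 => 0
  | n + 1 => ρ n + 1

def ren (ρ : Nat → Nat) : Tm C → Tm C
  | var n => var (ρ n)
  | const c Ms => const c (Ms.attach.map fun x => ren ρ x.1)
  | type => type
  | kind => kind
  | app M N => app (ren ρ M) (ren ρ N)
  | lam A M => lam (ren ρ A) (ren (liftRen ρ) M)
  | pi A B => pi (ren ρ A) (ren (liftRen ρ) B)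
termination_by t => sizeOf t
decreasing_by
  all_goals simp_wf
  all_goals try omega
  all_goals (have h := List.sizeOf_lt_of_mem x.2; omega)

def liftSub (σ : Nat → Tm C) : Nat → Tm C
  | 0 => var 0
  | n + 1 => ren Nat.succ (σ n)

def sub (σ : Nat → Tm C) : Tm C → Tm C
  | var n => σ n
  | const c Ms => const c (Ms.attach.map fun x => sub σ x.1)
  | type => type
  | kind => kind
  | app M N => app (sub σ M) (sub σ N)
  | lam A M => lam (sub σ A) (sub (liftSub σ) M)
  | pi A B => pi (sub σ A) (sub (liftSub σ) B)
termination_by t => sizeOf t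
decreasing_by
  all_goals simp_wf
  all_goals try omega
  all_goals (have h := List.sizeOf_lt_of_mem x.2; omega)

/-- Substitution of `N` for the variable of de Bruijn index `k` (the usual `M{N/x}`). -/
def substAt (k : Nat) (N : Tm C) : Tm C → Tm C :=
  sub fun n => if n < k then var n else if n = k then ren (· + k) N else var (n - 1)

end Tm

/-! ## Signatures, rewrite rules, rewriting -/

/-- An entry `c[Δ] : A` of a signature: head constant, telescope (in declaration
order, each entry a type under the previous ones), and the type. -/
abbrev Sig (C : Type) := Set (C × List (Tm C) × Tm C)

/-- A rewrite rule `c[l⃗] ↪ r`: head constant, list of left-hand side argument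
patterns (free de Bruijn variables are the pattern variables), right-hand side. -/
abbrev Rules (C : Type) := Set (C × List (Tm C) × Tm C)

variable {C : Type}

/-- Closure of a root relation under all term-forming contexts. -/
inductive Cong (r : Tm C → Tm C → Prop) : Tm C → Tm C → Prop
  | base {M N} : r M N → Cong r M N
  | appL {M M' N} : Cong r M M' → Cong r (.app M N) (.app M' N)
  | appR {M N N'} : Cong r N N' → Cong r (.app M N) (.app M N')
  | lamA {A A' M} : Cong r A A' → Cong r (.lam A M) (.lam A' M)
  | lamM {A M M'} : Cong r M M' → Cong r (.lam A M) (.lam A M')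
  | piA {A A' B} : Cong r A A' → Cong r (.pi A B) (.pi A' B)
  | piB {A B B'} : Cong r B B' → Cong r (.pi A B) (.pi A B')
  | constArg {c l₁ M M' l₂} : Cong r M M' →
      Cong r (.const c (l₁ ++ M :: l₂)) (.const c (l₁ ++ M' :: l₂))

/-- Root β-reduction. -/
def BetaRoot : Tm C → Tm C → Prop := fun M N =>
  ∃ A P Q, M = .app (.lam A P) Q ∧ N = Tm.substAt 0 Q P

/-- Root reduction by a rule of `R`: a substitution instance of some rule. -/
def RuleRoot (R : Rules C) : Tm C → Tm C → Prop := fun M N =>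
  ∃ rl ∈ R, ∃ σ : Nat → Tm C,
    M = Tm.sub σ (.const rl.1 rl.2.1) ∧ N = Tm.sub σ rl.2.2

/-- One-step β-reduction `↪_β`. -/
def Beta : Tm C → Tm C → Prop := Cong BetaRoot

/-- One-step reduction by the rules of `R` only (no β). -/
def RStep (R : Rules C) : Tm C → Tm C → Prop := Cong (RuleRoot R)

/-- One-step reduction `↪_{β𝓡}`. -/
def Step (R : Rules C) : Tm C → Tm C → Prop :=
  Cong (fun M N => BetaRoot M N ∨ RuleRoot R M N)

/-- The conversion `≡_{β𝓡}` generated by `↪_{β𝓡}`. -/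
def Conv (R : Rules C) : Tm C → Tm C → Prop := Relation.EqvGen (Step R)

/-- Confluence of an abstract reduction relation. -/
def Confluent {α : Type _} (r : α → α → Prop) : Prop :=
  ∀ a b c, Relation.ReflTransGen r a b → Relation.ReflTransGen r a c →
    ∃ d, Relation.ReflTransGen r b d ∧ Relation.ReflTransGen r c d

/-- `M` is in β-normal form. -/
def BetaNormal (M : Tm C) : Prop := ∀ N, ¬ Beta M N

/-- Strong normalization of a relation at a point: no infinite `r`-sequence starts at `a`. -/
def SN {α : Type _} (r : α → α → Prop) (a : α) : Prop := Acc (fun x y => r y x) a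


/-! ## Dedukti typing -/

/-- `IsDKSort s` means `s` is `TYPE` or `KIND`. -/
def IsDKSort (s : Tm C) : Prop := s = Tm.type ∨ s = Tm.kind

/-- `A{M⃗}`: simultaneous instantiation of the telescope variables by the arguments. -/
def instArgs (Ms : List (Tm C)) (A : Tm C) : Tm C :=
  Tm.sub (fun n => Ms.reverse.getD n (Tm.var (n - Ms.length))) A

/-- Instantiate the first variable of the (remaining) telescope `Δ` with `M`. -/
def instTele (M : Tm C) (Δ : List (Tm C)) : List (Tm C) :=
  Δ.mapIdx fun i B => Tm.substAt i M B

mutual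
/-- Well-formed contexts `Σ;Γ well-formed` (de Bruijn: last declaration first). -/
inductive Wf (S : Sig C) (R : Rules C) : List (Tm C) → Prop
  | empty : Wf S R []
  | decl {Γ A} : Typed S R Γ A Tm.type → Wf S R (A :: Γ)

/-- The Dedukti typing judgment `Σ;Γ ⊢ M : A`. -/
inductive Typed (S : Sig C) (R : Rules C) : List (Tm C) → Tm C → Tm C → Prop
  | sort {Γ} : Wf S R Γ → Typed S R Γ Tm.type Tm.kind
  | var {Γ n A} : Wf S R Γ → Γ[n]? = some A →
      Typed S R Γ (Tm.var n) (Tm.ren (· + (n + 1)) A)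
  | cons {Γ c Δ A s Ms} : (c, Δ, A) ∈ S → Typed S R Δ.reverse A s → IsDKSort s →
      TypedArgs S R Γ Ms Δ → Typed S R Γ (Tm.const c Ms) (instArgs Ms A)
  | conv {Γ M A B s} : Typed S R Γ M A → Typed S R Γ B s → IsDKSort s →
      Conv R A B → Typed S R Γ M B
  | prod {Γ A B s} : Typed S R Γ A Tm.type → Typed S R (A :: Γ) B s → IsDKSort s →
      Typed S R Γ (Tm.pi A B) s
  | abs {Γ A B s M} : Typed S R Γ A Tm.type → Typed S R (A :: Γ) B s → IsDKSort s →
      Typed S R (A :: Γ) M B → Typed S R Γ (Tm.lam A M) (Tm.pi A B)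
  | app {Γ M N A B} : Typed S R Γ M (Tm.pi A B) → Typed S R Γ N A →
      Typed S R Γ (Tm.app M N) (Tm.substAt 0 N B)

/-- `Σ;Γ ⊢ M⃗ : Δ`: the arguments fit the telescope. -/
inductive TypedArgs (S : Sig C) (R : Rules C) : List (Tm C) → List (Tm C) → List (Tm C) → Prop
  | nil {Γ} : TypedArgs S R Γ [] []
  | cons {Γ M Ms A Δ} : Typed S R Γ M A → TypedArgs S R Γ Ms (instTele M Δ) →
      TypedArgs S R Γ (M :: Ms) (A :: Δ)
end

/-! ## Type-level and object-level constants, syntactic classes -/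

/-- Types of the form `Πx⃗:B⃗.TYPE`. -/
inductive IsKindShape : Tm C → Prop
  | type : IsKindShape Tm.type
  | pi {A K} : IsKindShape K → IsKindShape (Tm.pi A K)

/-- `c` is a type-level constant of the signature `S`. -/
def TypeLevel (S : Sig C) (c : C) : Prop := ∃ Δ A, (c, Δ, A) ∈ S ∧ IsKindShape A

/-- `c` is an object-level constant of the signature `S`: it is declared, and not type-level. -/
def ObjLevel (S : Sig C) (c : C) : Prop := (∃ Δ A, (c, Δ, A) ∈ S) ∧ ¬ TypeLevel S c

mutual
/-- Kinds: `K ::= TYPE | Πx:T.K`. -/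
inductive IsKind (S : Sig C) : Tm C → Prop
  | type : IsKind S Tm.type
  | pi {T K} : IsTypeFam S T → IsKind S K → IsKind S (Tm.pi T K)

/-- Type families: `T ::= α[O⃗] | T O | λx:T.T | Πx:T.T` with `α` type-level. -/
inductive IsTypeFam (S : Sig C) : Tm C → Prop
  | const {c Os} : TypeLevel S c → (∀ O ∈ Os, IsObj S O) → IsTypeFam S (Tm.const c Os)
  | app {T O} : IsTypeFam S T → IsObj S O → IsTypeFam S (Tm.app T O)
  | lam {T₁ T₂} : IsTypeFam S T₁ → IsTypeFam S T₂ → IsTypeFam S (Tm.lam T₁ T₂)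
  | pi {T₁ T₂} : IsTypeFam S T₁ → IsTypeFam S T₂ → IsTypeFam S (Tm.pi T₁ T₂)

/-- Objects: `O ::= x | a[O⃗] | O O | λx:T.O` with `a` object-level. -/
inductive IsObj (S : Sig C) : Tm C → Prop
  | var {n} : IsObj S (Tm.var n)
  | const {c Os} : ObjLevel S c → (∀ O ∈ Os, IsObj S O) → IsObj S (Tm.const c Os)
  | app {O₁ O₂} : IsObj S O₁ → IsObj S O₂ → IsObj S (Tm.app O₁ O₂)
  | lam {T O} : IsTypeFam S T → IsObj S O → IsObj S (Tm.lam T O)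
end

mutual
/-- Pre-kinds: `L ::= TYPE | Πx:R.L`. -/
inductive PreKind (S : Sig C) : Tm C → Prop
  | type : PreKind S Tm.type
  | pi {R L} : PreTypeFam S R → PreKind S L → PreKind S (Tm.pi R L)

/-- Pre-type families: `R ::= α[M⃗] | R N | λx:A.R | Πx:R.R` with `α` type-level
and `M⃗`, `N`, `A` arbitrary. -/
inductive PreTypeFam (S : Sig C) : Tm C → Prop
  | const {c Ms} : TypeLevel S c → PreTypeFam S (Tm.const c Ms)
  | app {R N} : PreTypeFam S R → PreTypeFam S (Tm.app R N)
  | lam {A R} : PreTypeFam S R → PreTypeFam S (Tm.lam A R)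
  | pi {R₁ R₂} : PreTypeFam S R₁ → PreTypeFam S R₂ → PreTypeFam S (Tm.pi R₁ R₂)
end

/-- A rewrite rule is type-level when its head constant is type-level. -/
def TypeLevelRule (S : Sig C) (rl : C × List (Tm C) × Tm C) : Prop := TypeLevel S rl.1

/-- The grammar `R ::= α[M⃗] | R N | λx:A.R` used to define arity preservation. -/
inductive APShape (S : Sig C) : Tm C → Prop
  | const {c Ms} : TypeLevel S c → APShape S (Tm.const c Ms)
  | app {R N} : APShape S R → APShape S (Tm.app R N)
  | lam {A R} : APShape S R → APShape S (Tm.lam A R)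

/-- `𝓡` is arity preserving (w.r.t. `Σ`). -/
def ArityPreserving (S : Sig C) (R : Rules C) : Prop :=
  ∀ rl ∈ R, TypeLevelRule S rl → APShape S rl.2.2

/-- `𝓡` is well-formed (w.r.t. `Σ`): right-hand sides of type-level rules are in
the grammar `R ::= α[M⃗] | R N | λx:B.R | Πx:R.R`. -/
def RulesWellFormed (S : Sig C) (R : Rules C) : Prop :=
  ∀ rl ∈ R, TypeLevelRule S rl → PreTypeFam S rl.2.2

/-! ## Simple types and the erasure maps -/

/-- Simple types `σ ::= * | σ → σ`. -/
inductive STy : Type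
  | star : STy
  | arr : STy → STy → STy
deriving DecidableEq

open Classical in
/-- The partial type erasure `⌈·⌉` from Dedukti terms to simple types. -/
noncomputable def tyErase (S : Sig C) : Tm C → Option STy
  | Tm.type => some STy.star
  | Tm.const c _ => if TypeLevel S c then some STy.star else none
  | Tm.pi A B => do return STy.arr (← tyErase S A) (← tyErase S B)
  | Tm.app A _ => tyErase S A
  | Tm.lam _ B => tyErase S B
  | Tm.var _ => none
  | Tm.kind => none

/-- Untyped λ-terms with constants in `K` (the target of the term erasure). -/
inductive LTm (K : Type) : Type
  | var : Nat → LTm K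
  | const : K → LTm K
  | app : LTm K → LTm K → LTm K
  | lam : LTm K → LTm K

namespace LTm
variable {K : Type}

def liftRen' (ρ : Nat → Nat) : Nat → Nat
  | 0 => 0
  | n + 1 => ρ n + 1

def ren (ρ : Nat → Nat) : LTm K → LTm K
  | var n => var (ρ n)
  | const k => const k
  | app M N => app (ren ρ M) (ren ρ N)
  | lam M => lam (ren (liftRen' ρ) M)

/-- Shift free variables `≥ d` up by one. -/
def shiftAbove (d : Nat) : LTm K → LTm K :=
  ren fun n => if n < d then n else n + 1

def liftSub (σ : Nat → LTm K) : Nat → LTm K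
  | 0 => var 0
  | n + 1 => ren Nat.succ (σ n)

def sub (σ : Nat → LTm K) : LTm K → LTm K
  | var n => σ n
  | const k => const k
  | app M N => app (sub σ M) (sub σ N)
  | lam M => lam (sub (liftSub σ) M)

/-- Substitution `M{N/x}` for the variable of index `k`. -/
def substAt (k : Nat) (N : LTm K) : LTm K → LTm K :=
  sub fun n => if n < k then var n else if n = k then ren (· + k) N else var (n - 1)

end LTm

/-- β-reduction for the (simply-typed) λ-calculus. -/
inductive LBeta {K : Type} : LTm K → LTm K → Prop
  | red {M N} : LBeta (LTm.app (LTm.lam M) N) (LTm.substAt 0 N M)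
  | appL {M M' N} : LBeta M M' → LBeta (LTm.app M N) (LTm.app M' N)
  | appR {M N N'} : LBeta N N' → LBeta (LTm.app M N) (LTm.app M N')
  | lam {M M'} : LBeta M M' → LBeta (LTm.lam M) (LTm.lam M')

/-- The partial term erasure `|·|` from Dedukti terms into the λ-calculus with
constants `C ⊕ STy` (`Sum.inr σ` being the constant `π_σ`). -/
noncomputable def erase (S : Sig C) : Tm C → Option (LTm (C ⊕ STy))
  | Tm.var n => some (LTm.var n)
  | Tm.const c Ms => do
      let ts ← Ms.attach.mapM fun x => erase S x.1
      return ts.foldl LTm.app (LTm.const (Sum.inl c))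
  | Tm.app M N => do return LTm.app (← erase S M) (← erase S N)
  | Tm.lam A M => do
      return LTm.app (LTm.lam (LTm.lam (LTm.shiftAbove 1 (← erase S M)))) (← erase S A)
  | Tm.pi A B => do
      return LTm.app (LTm.app (LTm.const (Sum.inr (← tyErase S A))) (← erase S A))
        (LTm.lam (← erase S B))
  | Tm.type => none
  | Tm.kind => none
termination_by t => sizeOf t
decreasing_by
  all_goals simp_wf
  all_goals try omega
  all_goals (have h := List.sizeOf_lt_of_mem x.2; omega)

/-- The type `* → (σ → *) → *` of the constant `π_σ`. -/
def piConstTy (σ : STy) : STy := STy.arr STy.star (STy.arr (STy.arr σ STy.star) STy.star)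

/-- `⌈A₁⌉ → ... → ⌈Aₙ⌉ → ⌈A⌉`, as a relation (defined when all erasures are). -/
inductive EraseTele (S : Sig C) : List (Tm C) → Tm C → STy → Prop
  | nil {A σ} : tyErase S A = some σ → EraseTele S [] A σ
  | cons {B Δ A τ σ} : tyErase S B = some τ → EraseTele S Δ A σ →
      EraseTele S (B :: Δ) A (STy.arr τ σ)

/-- The simply-typed constant context `Γ_π, ⌈Σ'⌉`: it declares `π_σ : * → (σ → *) → *`
for every simple type `σ`, and `c : ⌈A₁⌉ → ... → ⌈Aₙ⌉ → ⌈A⌉` for every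
declaration `c[x₁:A₁,...,xₙ:Aₙ] : A` of `Σ'` (erasures being taken w.r.t. `S`). -/
inductive ConstTy (S : Sig C) (S' : Sig C) : C ⊕ STy → STy → Prop
  | piConst (σ : STy) : ConstTy S S' (Sum.inr σ) (piConstTy σ)
  | const {c Δ A σ} : (c, Δ, A) ∈ S' → EraseTele S Δ A σ → ConstTy S S' (Sum.inl c) σ

/-- Typing in the simply-typed λ-calculus, with constants typed by `cty`. -/
inductive STTyped {K : Type} (cty : K → STy → Prop) : List STy → LTm K → STy → Prop
  | var {Γ n σ} : Γ[n]? = some σ → STTyped cty Γ (LTm.var n) σ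
  | const {Γ k σ} : cty k σ → STTyped cty Γ (LTm.const k) σ
  | app {Γ M N σ τ} : STTyped cty Γ M (STy.arr σ τ) → STTyped cty Γ N σ →
      STTyped cty Γ (LTm.app M N) τ
  | lam {Γ M σ τ} : STTyped cty (σ :: Γ) M τ → STTyped cty Γ (LTm.lam M) (STy.arr σ τ)

/-! ## Explicitly-typed Pure Type Systems (EPTS) -/

/-- EPTS terms (de Bruijn): `x | s | Π_{s₁,s₂}(A,[x]B) | λ_{s₁,s₂}(A,[x]B,[x]M) |
@_{s₁,s₂}(A,[x]B,M,N)`. -/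
inductive ETm (S : Type) : Type
  | var : Nat → ETm S
  | sort : S → ETm S
  | pi : S → S → ETm S → ETm S → ETm S
  | lam : S → S → ETm S → ETm S → ETm S → ETm S
  | app : S → S → ETm S → ETm S → ETm S → ETm S → ETm S

namespace ETm
variable {S : Type}

def ren (ρ : Nat → Nat) : ETm S → ETm S
  | var n => var (ρ n)
  | sort s => sort s
  | pi s₁ s₂ A B => pi s₁ s₂ (ren ρ A) (ren (Tm.liftRen ρ) B)
  | lam s₁ s₂ A B M => lam s₁ s₂ (ren ρ A) (ren (Tm.liftRen ρ) B) (ren (Tm.liftRen ρ) M)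
  | app s₁ s₂ A B M N => app s₁ s₂ (ren ρ A) (ren (Tm.liftRen ρ) B) (ren ρ M) (ren ρ N)

def liftSub (σ : Nat → ETm S) : Nat → ETm S
  | 0 => var 0
  | n + 1 => ren Nat.succ (σ n)

def sub (σ : Nat → ETm S) : ETm S → ETm S
  | var n => σ n
  | sort s => sort s
  | pi s₁ s₂ A B => pi s₁ s₂ (sub σ A) (sub (liftSub σ) B)
  | lam s₁ s₂ A B M => lam s₁ s₂ (sub σ A) (sub (liftSub σ) B) (sub (liftSub σ) M)
  | app s₁ s₂ A B M N => app s₁ s₂ (sub σ A) (sub (liftSub σ) B) (sub σ M) (sub σ N)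

/-- Substitution `M{N/x}` for the variable of de Bruijn index `k`. -/
def substAt (k : Nat) (N : ETm S) : ETm S → ETm S :=
  sub fun n => if n < k then var n else if n = k then ren (· + k) N else var (n - 1)

end ETm

variable {S : Type}

/-- Closure of a root relation under all EPTS term-forming contexts. -/
inductive ECong (r : ETm S → ETm S → Prop) : ETm S → ETm S → Prop
  | base {M N} : r M N → ECong r M N
  | piA {s₁ s₂ A A' B} : ECong r A A' → ECong r (.pi s₁ s₂ A B) (.pi s₁ s₂ A' B)
  | piB {s₁ s₂ A B B'} : ECong r B B' → ECong r (.pi s₁ s₂ A B) (.pi s₁ s₂ A B')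
  | lamA {s₁ s₂ A A' B M} : ECong r A A' → ECong r (.lam s₁ s₂ A B M) (.lam s₁ s₂ A' B M)
  | lamB {s₁ s₂ A B B' M} : ECong r B B' → ECong r (.lam s₁ s₂ A B M) (.lam s₁ s₂ A B' M)
  | lamM {s₁ s₂ A B M M'} : ECong r M M' → ECong r (.lam s₁ s₂ A B M) (.lam s₁ s₂ A B M')
  | appA {s₁ s₂ A A' B M N} : ECong r A A' → ECong r (.app s₁ s₂ A B M N) (.app s₁ s₂ A' B M N)
  | appB {s₁ s₂ A B B' M N} : ECong r B B' → ECong r (.app s₁ s₂ A B M N) (.app s₁ s₂ A B' M N)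
  | appM {s₁ s₂ A B M M' N} : ECong r M M' → ECong r (.app s₁ s₂ A B M N) (.app s₁ s₂ A B M' N)
  | appN {s₁ s₂ A B M N N'} : ECong r N N' → ECong r (.app s₁ s₂ A B M N) (.app s₁ s₂ A B M N')

/-- Root β-reduction of the EPTS (linearized rule, one instance per `(s₁,s₂,s₃) ∈ ℛ`):
`@_{s₁,s₂}(A,[x]B, λ_{s₁,s₂}(A',[x]B',[x]M), N) ↪ M{N/x}`. -/
def EBetaRoot (Rrel : S → S → S → Prop) : ETm S → ETm S → Prop := fun M N =>
  ∃ s₁ s₂ s₃ A B A' B' P Q, Rrel s₁ s₂ s₃ ∧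
    M = ETm.app s₁ s₂ A B (ETm.lam s₁ s₂ A' B' P) Q ∧ N = ETm.substAt 0 Q P

/-- One-step EPTS reduction. -/
def EStep (Rrel : S → S → S → Prop) : ETm S → ETm S → Prop := ECong (EBetaRoot Rrel)

/-- EPTS conversion `≡`. -/
def EConv (Rrel : S → S → S → Prop) : ETm S → ETm S → Prop := Relation.EqvGen (EStep Rrel)

mutual
/-- Well-formed EPTS contexts. -/
inductive EWf (Ar : S → S → Prop) (Rr : S → S → S → Prop) : List (ETm S) → Prop
  | empty : EWf Ar Rr []
  | decl {Γ A s} : ETyped Ar Rr Γ A (ETm.sort s) → EWf Ar Rr (A :: Γ)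

/-- The EPTS typing judgment `Γ ⊢ M : A`. -/
inductive ETyped (Ar : S → S → Prop) (Rr : S → S → S → Prop) : List (ETm S) → ETm S → ETm S → Prop
  | sort {Γ s₁ s₂} : EWf Ar Rr Γ → Ar s₁ s₂ → ETyped Ar Rr Γ (ETm.sort s₁) (ETm.sort s₂)
  | var {Γ n A} : EWf Ar Rr Γ → Γ[n]? = some A →
      ETyped Ar Rr Γ (ETm.var n) (ETm.ren (· + (n + 1)) A)
  | conv {Γ M A B s} : ETyped Ar Rr Γ M A → ETyped Ar Rr Γ B (ETm.sort s) →
      EConv Rr A B → ETyped Ar Rr Γ M B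
  | pi {Γ s₁ s₂ s₃ A B} : Rr s₁ s₂ s₃ → ETyped Ar Rr Γ A (ETm.sort s₁) →
      ETyped Ar Rr (A :: Γ) B (ETm.sort s₂) →
      ETyped Ar Rr Γ (ETm.pi s₁ s₂ A B) (ETm.sort s₃)
  | lam {Γ s₁ s₂ s₃ A B M} : Rr s₁ s₂ s₃ → ETyped Ar Rr Γ A (ETm.sort s₁) →
      ETyped Ar Rr (A :: Γ) B (ETm.sort s₂) → ETyped Ar Rr (A :: Γ) M B →
      ETyped Ar Rr Γ (ETm.lam s₁ s₂ A B M) (ETm.pi s₁ s₂ A B)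
  | app {Γ s₁ s₂ s₃ A B M N} : Rr s₁ s₂ s₃ → ETyped Ar Rr Γ A (ETm.sort s₁) →
      ETyped Ar Rr (A :: Γ) B (ETm.sort s₂) → ETyped Ar Rr Γ N A →
      ETyped Ar Rr Γ M (ETm.pi s₁ s₂ A B) →
      ETyped Ar Rr Γ (ETm.app s₁ s₂ A B M N) (ETm.substAt 0 N B)
end

/-- `𝒜` and `ℛ` are functional relations. -/
def FunctionalSpec (Ar : S → S → Prop) (Rr : S → S → S → Prop) : Prop :=
  (∀ s t t', Ar s t → Ar s t' → t = t') ∧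
  (∀ s₁ s₂ t t', Rr s₁ s₂ t → Rr s₁ s₂ t' → t = t')

/-- `s` is a top-sort. -/
def IsTopSort (Ar : S → S → Prop) (s : S) : Prop := ¬ ∃ s', Ar s s'

/-- `Γ ⊢ A type`: `A` is a sort, or `Γ ⊢ A : s` for some sort `s`. -/
def ETypeJ (Ar : S → S → Prop) (Rr : S → S → S → Prop) (Γ : List (ETm S)) (A : ETm S) : Prop :=
  (∃ s, A = ETm.sort s) ∨ ∃ s, ETyped Ar Rr Γ A (ETm.sort s)

/-! ## (Implicit) Pure Type Systems -/

/-- PTS terms. -/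
inductive PTm (S : Type) : Type
  | var : Nat → PTm S
  | sort : S → PTm S
  | pi : PTm S → PTm S → PTm S
  | lam : PTm S → PTm S → PTm S
  | app : PTm S → PTm S → PTm S

namespace PTm
variable {S : Type}

def ren (ρ : Nat → Nat) : PTm S → PTm S
  | var n => var (ρ n)
  | sort s => sort s
  | pi A B => pi (ren ρ A) (ren (Tm.liftRen ρ) B)
  | lam A M => lam (ren ρ A) (ren (Tm.liftRen ρ) M)
  | app M N => app (ren ρ M) (ren ρ N)

def liftSub (σ : Nat → PTm S) : Nat → PTm S
  | 0 => var 0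
  | n + 1 => ren Nat.succ (σ n)

def sub (σ : Nat → PTm S) : PTm S → PTm S
  | var n => σ n
  | sort s => sort s
  | pi A B => pi (sub σ A) (sub (liftSub σ) B)
  | lam A M => lam (sub σ A) (sub (liftSub σ) M)
  | app M N => app (sub σ M) (sub σ N)

def substAt (k : Nat) (N : PTm S) : PTm S → PTm S :=
  sub fun n => if n < k then var n else if n = k then ren (· + k) N else var (n - 1)

end PTm

/-- One-step β-reduction of PTS terms. -/
inductive PBeta : PTm S → PTm S → Prop
  | red {A M N} : PBeta (PTm.app (PTm.lam A M) N) (PTm.substAt 0 N M)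
  | piA {A A' B} : PBeta A A' → PBeta (PTm.pi A B) (PTm.pi A' B)
  | piB {A B B'} : PBeta B B' → PBeta (PTm.pi A B) (PTm.pi A B')
  | lamA {A A' M} : PBeta A A' → PBeta (PTm.lam A M) (PTm.lam A' M)
  | lamM {A M M'} : PBeta M M' → PBeta (PTm.lam A M) (PTm.lam A M')
  | appL {M M' N} : PBeta M M' → PBeta (PTm.app M N) (PTm.app M' N)
  | appR {M N N'} : PBeta N N' → PBeta (PTm.app M N) (PTm.app M N')

/-- PTS conversion. -/
def PConv : PTm S → PTm S → Prop := Relation.EqvGen PBeta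

mutual
/-- Well-formed PTS contexts. -/
inductive PWf (Ar : S → S → Prop) (Rr : S → S → S → Prop) : List (PTm S) → Prop
  | empty : PWf Ar Rr []
  | decl {Γ A s} : PTyped Ar Rr Γ A (PTm.sort s) → PWf Ar Rr (A :: Γ)

/-- The PTS typing judgment. -/
inductive PTyped (Ar : S → S → Prop) (Rr : S → S → S → Prop) : List (PTm S) → PTm S → PTm S → Prop
  | sort {Γ s₁ s₂} : PWf Ar Rr Γ → Ar s₁ s₂ → PTyped Ar Rr Γ (PTm.sort s₁) (PTm.sort s₂)
  | var {Γ n A} : PWf Ar Rr Γ → Γ[n]? = some A →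
      PTyped Ar Rr Γ (PTm.var n) (PTm.ren (· + (n + 1)) A)
  | conv {Γ M A B s} : PTyped Ar Rr Γ M A → PTyped Ar Rr Γ B (PTm.sort s) →
      PConv A B → PTyped Ar Rr Γ M B
  | pi {Γ s₁ s₂ s₃ A B} : Rr s₁ s₂ s₃ → PTyped Ar Rr Γ A (PTm.sort s₁) →
      PTyped Ar Rr (A :: Γ) B (PTm.sort s₂) →
      PTyped Ar Rr Γ (PTm.pi A B) (PTm.sort s₃)
  | lam {Γ s₁ s₂ s₃ A B M} : Rr s₁ s₂ s₃ → PTyped Ar Rr Γ A (PTm.sort s₁) →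
      PTyped Ar Rr (A :: Γ) B (PTm.sort s₂) → PTyped Ar Rr (A :: Γ) M B →
      PTyped Ar Rr Γ (PTm.lam A M) (PTm.pi A B)
  | app {Γ A B M N} : PTyped Ar Rr Γ M (PTm.pi A B) → PTyped Ar Rr Γ N A →
      PTyped Ar Rr Γ (PTm.app M N) (PTm.substAt 0 N B)
end

/-- `Γ ⊢_PTS A type`. -/
def PTypeJ (Ar : S → S → Prop) (Rr : S → S → S → Prop) (Γ : List (PTm S)) (A : PTm S) : Prop :=
  (∃ s, A = PTm.sort s) ∨ ∃ s, PTyped Ar Rr Γ A (PTm.sort s)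

/-- The natural erasure from EPTS terms to PTS terms. -/
def epsErase : ETm S → PTm S
  | ETm.var n => PTm.var n
  | ETm.sort s => PTm.sort s
  | ETm.pi _ _ A B => PTm.pi (epsErase A) (epsErase B)
  | ETm.lam _ _ A _ M => PTm.lam (epsErase A) (epsErase M)
  | ETm.app _ _ _ _ M N => PTm.app (epsErase M) (epsErase N)

/-! ## The encoding of EPTSs in Dedukti -/

/-- The constants of the theory `(Σ_EPTS, 𝓡_EPTS)`. -/
inductive EConst (S : Type) : Type
  | U : S → EConst S
  | El : S → EConst S
  | u : S → EConst S
  | Prod : S → S → EConst S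
  | abs : S → S → EConst S
  | app : S → S → EConst S

/-- `U_s`. -/
def Ucon (s : S) : Tm (EConst S) := Tm.const (EConst.U s) []
/-- `El_s A`. -/
def Elcon (s : S) (A : Tm (EConst S)) : Tm (EConst S) := Tm.const (EConst.El s) [A]
/-- `u_s`. -/
def ucon (s : S) : Tm (EConst S) := Tm.const (EConst.u s) []
/-- `Prod_{s₁,s₂} A B`. -/
def ProdC (s₁ s₂ : S) (A B : Tm (EConst S)) : Tm (EConst S) :=
  Tm.const (EConst.Prod s₁ s₂) [A, B]
/-- `abs_{s₁,s₂} A B M`. -/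
def absC (s₁ s₂ : S) (A B M : Tm (EConst S)) : Tm (EConst S) :=
  Tm.const (EConst.abs s₁ s₂) [A, B, M]
/-- `app_{s₁,s₂} A B M N`. -/
def appC (s₁ s₂ : S) (A B M N : Tm (EConst S)) : Tm (EConst S) :=
  Tm.const (EConst.app s₁ s₂) [A, B, M, N]

/-- The signature `Σ_EPTS` (telescopes in de Bruijn form). -/
inductive SigEPTSMem (Ar : S → S → Prop) (Rr : S → S → S → Prop) :
    EConst S × List (Tm (EConst S)) × Tm (EConst S) → Prop
  | U (s : S) : SigEPTSMem Ar Rr (EConst.U s, [], Tm.type)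
  | El (s : S) : SigEPTSMem Ar Rr (EConst.El s, [Ucon s], Tm.type)
  | u {s₁ s₂} : Ar s₁ s₂ → SigEPTSMem Ar Rr (EConst.u s₁, [], Ucon s₂)
  | Prod {s₁ s₂ s₃} : Rr s₁ s₂ s₃ →
      SigEPTSMem Ar Rr (EConst.Prod s₁ s₂,
        [Ucon s₁, Tm.pi (Elcon s₁ (Tm.var 0)) (Ucon s₂)],
        Ucon s₃)
  | abs {s₁ s₂ s₃} : Rr s₁ s₂ s₃ →
      SigEPTSMem Ar Rr (EConst.abs s₁ s₂,
        [Ucon s₁, Tm.pi (Elcon s₁ (Tm.var 0)) (Ucon s₂),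
         Tm.pi (Elcon s₁ (Tm.var 1)) (Elcon s₂ (Tm.app (Tm.var 1) (Tm.var 0)))],
        Elcon s₃ (ProdC s₁ s₂ (Tm.var 2) (Tm.var 1)))
  | app {s₁ s₂ s₃} : Rr s₁ s₂ s₃ →
      SigEPTSMem Ar Rr (EConst.app s₁ s₂,
        [Ucon s₁, Tm.pi (Elcon s₁ (Tm.var 0)) (Ucon s₂),
         Elcon s₃ (ProdC s₁ s₂ (Tm.var 1) (Tm.var 0)),
         Elcon s₁ (Tm.var 2)],
        Elcon s₂ (Tm.app (Tm.var 2) (Tm.var 0)))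

/-- `Σ_EPTS` as a signature. -/
def sigEPTS (Ar : S → S → Prop) (Rr : S → S → S → Prop) : Sig (EConst S) :=
  fun e => SigEPTSMem Ar Rr e

/-- The rules `El_{s₂} u_{s₁} ↪ U_{s₁}` for `(s₁,s₂) ∈ 𝒜`. -/
inductive URulesMem (Ar : S → S → Prop) :
    EConst S × List (Tm (EConst S)) × Tm (EConst S) → Prop
  | u_red {s₁ s₂} : Ar s₁ s₂ → URulesMem Ar (EConst.El s₂, [ucon s₁], Ucon s₁)

/-- The rules `app_{s₁,s₂} A B (abs_{s₁,s₂} A' B' M) N ↪ M N` for `(s₁,s₂,s₃) ∈ ℛ`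
(pattern variables `A,B,A',B',M,N` are the de Bruijn variables `0,…,5`). -/
inductive BetaRulesMem (Rr : S → S → S → Prop) :
    EConst S × List (Tm (EConst S)) × Tm (EConst S) → Prop
  | beta {s₁ s₂ s₃} : Rr s₁ s₂ s₃ →
      BetaRulesMem Rr (EConst.app s₁ s₂,
        [Tm.var 0, Tm.var 1, absC s₁ s₂ (Tm.var 2) (Tm.var 3) (Tm.var 4), Tm.var 5],
        Tm.app (Tm.var 4) (Tm.var 5))

/-- The `u_{s₁}`-red rules as a rule set. -/
def uRules (Ar : S → S → Prop) : Rules (EConst S) := fun e => URulesMem Ar e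

/-- The `beta_{s₁,s₂}` rules as a rule set. -/
def betaRules (Rr : S → S → S → Prop) : Rules (EConst S) := fun e => BetaRulesMem Rr e

/-- The rewrite system `𝓡_EPTS`. -/
def rulesEPTS (Ar : S → S → Prop) (Rr : S → S → S → Prop) : Rules (EConst S) :=
  uRules Ar ∪ betaRules Rr

/-- The translation `⟦·⟧` from EPTS terms to Dedukti terms. -/
def trans : ETm S → Tm (EConst S)
  | ETm.var n => Tm.var n
  | ETm.sort s => ucon s
  | ETm.pi s₁ s₂ A B =>
      ProdC s₁ s₂ (trans A) (Tm.lam (Elcon s₁ (trans A)) (trans B))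
  | ETm.lam s₁ s₂ A B M =>
      absC s₁ s₂ (trans A) (Tm.lam (Elcon s₁ (trans A)) (trans B))
        (Tm.lam (Elcon s₁ (trans A)) (trans M))
  | ETm.app s₁ s₂ A B M N =>
      appC s₁ s₂ (trans A) (Tm.lam (Elcon s₁ (trans A)) (trans B)) (trans M) (trans N)

/-- The translation `⟦·⟧` on (well-formed) contexts: `⟦Γ, x:A⟧ = ⟦Γ⟧, x : El_{s_A} ⟦A⟧`
where `Γ ⊢ A : s_A`. -/
inductive TransCtx (Ar : S → S → Prop) (Rr : S → S → S → Prop) :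
    List (ETm S) → List (Tm (EConst S)) → Prop
  | nil : TransCtx Ar Rr [] []
  | cons {Γ Δ A sA} : TransCtx Ar Rr Γ Δ → ETyped Ar Rr Γ A (ETm.sort sA) →
      TransCtx Ar Rr (A :: Γ) (Elcon sA (trans A) :: Δ)

/-- Invertible forms. -/
inductive Invertible : Tm (EConst S) → Prop
  | var {n} : Invertible (Tm.var n)
  | u {s} : Invertible (ucon s)
  | abs {s₁ s₂ A T₁ B T₂ M} : Invertible A → Invertible B → Invertible M →
      Invertible (absC s₁ s₂ A (Tm.lam T₁ B) (Tm.lam T₂ M))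
  | beta {T M N} : Invertible M → Invertible N →
      Invertible (Tm.app (Tm.lam T M) N)
  | prod {s₁ s₂ A T₁ B} : Invertible A → Invertible B →
      Invertible (ProdC s₁ s₂ A (Tm.lam T₁ B))
  | app {s₁ s₂ A T₁ B M N} : Invertible A → Invertible B → Invertible M → Invertible N →
      Invertible (appC s₁ s₂ A (Tm.lam T₁ B) M N)

/-- The inverse translation `|·|`, defined (at least) on invertible forms. -/
def inv : Tm (EConst S) → Option (ETm S)
  | Tm.var n => some (ETm.var n)
  | Tm.const (EConst.u s) [] => some (ETm.sort s)
  | Tm.app (Tm.lam _ M) N => do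
      return ETm.substAt 0 (← inv N) (← inv M)
  | Tm.const (EConst.Prod s₁ s₂) [A, Tm.lam _ B] => do
      return ETm.pi s₁ s₂ (← inv A) (← inv B)
  | Tm.const (EConst.abs s₁ s₂) [A, Tm.lam _ B, Tm.lam _ M] => do
      return ETm.lam s₁ s₂ (← inv A) (← inv B) (← inv M)
  | Tm.const (EConst.app s₁ s₂) [A, Tm.lam _ B, M, N] => do
      return ETm.app s₁ s₂ (← inv A) (← inv B) (← inv M) (← inv N)
  | _ => none
termination_by t => sizeOf t
decreasing_by
  all_goals simp_wf
  all_goals omega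

/-- Hidden rewriting steps: a `↪_{β𝓡}` step inside the type annotation of a binder. -/
def HStep (R : Rules (EConst S)) : Tm (EConst S) → Tm (EConst S) → Prop :=
  Cong fun M N => ∃ A A' P, Step R A A' ∧ M = Tm.lam A P ∧ N = Tm.lam A' P

/-- The hidden conversion `≡_H`. -/
def HConv (R : Rules (EConst S)) : Tm (EConst S) → Tm (EConst S) → Prop :=
  Relation.EqvGen (HStep R)


theorem tyErase_pi_eq_some {C : Type} {S : Sig C} {A B : Tm C} {τ : STy} :
    tyErase S (Tm.pi A B) = some τ ↔
      ∃ τ₁ τ₂, tyErase S A = some τ₁ ∧ tyErase S B = some τ₂ ∧ STy.arr τ₁ τ₂ = τ := by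
  simp [tyErase, Option.bind_eq_some_iff]

/-- The type erasure is invariant under arbitrary simultaneous substitutions. -/
theorem tyErase_sub {C : Type} {S : Sig C} : ∀ {A : Tm C} {τ : STy} (σ : Nat → Tm C),
    tyErase S A = some τ → tyErase S (Tm.sub σ A) = some τ
  | .var _, _, _, h => by simp [tyErase] at h
  | .const _ _, _, _, h => by simpa [Tm.sub, tyErase] using h
  | .type, _, _, h => by simpa [Tm.sub, tyErase] using h
  | .kind, _, _, h => by simp [tyErase] at h
  | .app M _, _, σ, h => by
      rw [tyErase] at h
      rw [Tm.sub, tyErase]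
      exact tyErase_sub σ h
  | .lam _ M, _, σ, h => by
      rw [tyErase] at h
      rw [Tm.sub, tyErase]
      exact tyErase_sub (Tm.liftSub σ) h
  | .pi A B, _, σ, h => by
      obtain ⟨τ₁, τ₂, hA, hB, hτ⟩ := tyErase_pi_eq_some.1 h
      rw [Tm.sub]
      exact tyErase_pi_eq_some.2
        ⟨τ₁, τ₂, tyErase_sub σ hA, tyErase_sub (Tm.liftSub σ) hB, hτ⟩

theorem APShape.tyErase_eq_star {C : Type} {S : Sig C} {M : Tm C} (h : APShape S M) :
    tyErase S M = some STy.star := by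
  induction h with
  | const hc => simp [tyErase, hc]
  | app _ ih => simpa [tyErase] using ih
  | lam _ ih => simpa [tyErase] using ih

theorem BetaRoot.tyErase_eq {C : Type} {S : Sig C} {M N : Tm C} {τ : STy}
    (h : BetaRoot M N) (hM : tyErase S M = some τ) : tyErase S N = some τ := by
  obtain ⟨A, P, Q, rfl, rfl⟩ := h
  exact tyErase_sub _ hM

theorem RuleRoot.tyErase_eq {C : Type} {S : Sig C} {R : Rules C} (hap : ArityPreserving S R)
    {M N : Tm C} {τ : STy} (h : RuleRoot R M N) (hM : tyErase S M = some τ) :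
    tyErase S N = some τ := by
  obtain ⟨rl, hrl, σ, rfl, rfl⟩ := h
  rw [Tm.sub, tyErase] at hM
  split_ifs at hM with hc
  rw [← hM]
  exact tyErase_sub σ (hap rl hrl hc).tyErase_eq_star

theorem Step.tyErase_eq {C : Type} {S : Sig C} {R : Rules C} (hap : ArityPreserving S R)
    {M N : Tm C} {τ : STy} (h : Step R M N) (hM : tyErase S M = some τ) :
    tyErase S N = some τ := by
  induction h generalizing τ with
  | base h => exact h.elim (fun h => h.tyErase_eq hM) (fun h => h.tyErase_eq hap hM)
  | appL _ ih => exact ih hM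
  | appR _ _ => exact hM
  | lamA _ _ => exact hM
  | lamM _ ih => exact ih hM
  | piA _ ih =>
      obtain ⟨τ₁, τ₂, hA, hB, hτ⟩ := tyErase_pi_eq_some.1 hM
      exact tyErase_pi_eq_some.2 ⟨τ₁, τ₂, ih hA, hB, hτ⟩
  | piB _ ih =>
      obtain ⟨τ₁, τ₂, hA, hB, hτ⟩ := tyErase_pi_eq_some.1 hM
      exact tyErase_pi_eq_some.2 ⟨τ₁, τ₂, hA, ih hB, hτ⟩
  | constArg _ _ => simpa [tyErase] using hM

theorem tyErase_eq_of_reduces {C : Type} {S : Sig C} {R : Rules C} (hap : ArityPreserving S R)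
    {M N : Tm C} {τ : STy} (h : Relation.ReflTransGen (Step R) M N)
    (hM : tyErase S M = some τ) : tyErase S N = some τ := by
  induction h with
  | refl => exact hM
  | tail _ hstep ih => exact hstep.tyErase_eq hap ih

/-- The Church–Rosser property: convertible elements of a confluent relation are joinable. -/
theorem Confluent.join_of_eqvGen {α : Type*} {r : α → α → Prop} (hr : Confluent r) {a b : α}
    (h : Relation.EqvGen r a b) : Relation.Join (Relation.ReflTransGen r) a b := by
  induction h with
  | rel _ b h => exact ⟨b, .single h, .refl⟩
  | refl a => exact ⟨a, .refl, .refl⟩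
  | symm _ _ _ ih =>
      obtain ⟨d, hx, hy⟩ := ih
      exact ⟨d, hy, hx⟩
  | trans _ b _ _ _ ih₁ ih₂ =>
      obtain ⟨d, had, hbd⟩ := ih₁
      obtain ⟨e, hbe, hce⟩ := ih₂
      obtain ⟨f, hdf, hef⟩ := hr b d e hbd hbe
      exact ⟨f, had.trans hdf, hce.trans hef⟩

/-- Key property: the type erasure is invariant under substitution,
reduction and conversion. -/
theorem tyErase_invariant {C : Type} (S : Sig C) (R : Rules C)
    (hSfin : S.Finite)
    (hconf : Confluent (Step R)) (hap : ArityPreserving S R) :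
    (∀ (A : Tm C) (σ : STy), tyErase S A = some σ →
      ∀ (N : Tm C) (k : Nat), tyErase S (Tm.substAt k N A) = some σ) ∧
    (∀ (A A' : Tm C) (σ : STy), Step R A A' → tyErase S A = some σ →
      tyErase S A' = some σ) ∧
    (∀ (A A' : Tm C) (σ σ' : STy), Conv R A A' →
      tyErase S A = some σ → tyErase S A' = some σ' → σ = σ') := by
  refine ⟨fun _ _ h _ _ => tyErase_sub _ h, fun _ _ _ h => h.tyErase_eq hap, ?_⟩
  intro A A' σ σ' hconv hA hA'
  obtain ⟨D, hAD, hAD'⟩ := hconf.join_of_eqvGen hconv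
  exact Option.some.inj
    ((tyErase_eq_of_reduces hap hAD hA).symm.trans (tyErase_eq_of_reduces hap hAD' hA'))

end DKPaper
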